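/- arXiv:2311.05531 — 2 statements merged into one kernel-verified Lean document; each statement's English description precedes it below -/
import Mathlib

section
/- Let M1 and M2 be the 6×6 0-1 matrices M1 = [[1,0,0,0,0,0],[1,0,1,1,1,0],[1,1,1,1,1,0],[0,0,0,1,1,0],[0,0,0,1,0,0],[0,0,0,1,1,1]] and M2 = [[0,0,0,1,0,0],[1,1,0,1,1,0],[1,0,1,1,1,1],[1,0,0,1,0,0],[0,0,0,0,1,0],[0,0,1,1,1,0]]. Then M1, M2 ∈ BCT((1,4,5,2,1,3),(3,1,2,5,4,1)), M1 ≤_B M2 in the combinatorial Bruhat order, but M1 ≤_{secB} M2 does NOT hold in the combinatorial secondary Bruhat order. In particular the two combinatorial Bruhat orders differ on BCT((1,4,5,2,1,3),(3,1,2,5,4,1)). -/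
open Finset

/-- `M` is a 0-1 matrix with row sum vector `r` and column sum vector `c`. -/
def isBCT {m n : ℕ} (r : Fin m → ℕ) (c : Fin n → ℕ) (M : Fin m → Fin n → ℕ) : Prop :=
  (∀ i j, M i j = 0 ∨ M i j = 1) ∧ (∀ i, ∑ j, M i j = r i) ∧ (∀ j, ∑ i, M i j = c j)

/-- `M'` is obtained from `M` by a single `L2 → I2` interchange. -/
def InterchangeStep {m n : ℕ} (M M' : Fin m → Fin n → ℕ) : Prop :=
  ∃ (i j : Fin m) (k l : Fin n), i < j ∧ k < l ∧
    M i k = 0 ∧ M i l = 1 ∧ M j k = 1 ∧ M j l = 0 ∧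
    M' i k = 1 ∧ M' i l = 0 ∧ M' j k = 0 ∧ M' j l = 1 ∧
    (∀ p q, ¬((p = i ∨ p = j) ∧ (q = k ∨ q = l)) → M' p q = M p q)

/-- The combinatorial secondary Bruhat order: `M1 ≤ M2` iff `M1` is obtained from `M2`
by a (possibly empty) finite sequence of `L2 → I2` interchanges. -/
def secBLE {m n : ℕ} (M1 M2 : Fin m → Fin n → ℕ) : Prop :=
  Relation.ReflTransGen InterchangeStep M2 M1

/-- `σ(M)_{ij} = ∑_{k ≤ i} ∑_{l ≤ j} m_{kl}`. -/
def sigmaM {m n : ℕ} (M : Fin m → Fin n → ℕ) (i : Fin m) (j : Fin n) : ℕ :=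
  ∑ k ∈ Finset.univ.filter (fun k : Fin m => k ≤ i),
    ∑ l ∈ Finset.univ.filter (fun l : Fin n => l ≤ j), M k l

/-- The combinatorial Bruhat order: `M1 ≤_B M2` iff `σ(M1) ≥ σ(M2)` entrywise. -/
def bruhatLE {m n : ℕ} (M1 M2 : Fin m → Fin n → ℕ) : Prop :=
  ∀ i j, sigmaM M2 i j ≤ sigmaM M1 i j

/-- An `L2 → I2` interchange on rows `i < j` and columns `k < l` raises `sigmaM` by one on the
rectangle `[i, j) × [k, l)` and leaves it unchanged elsewhere. -/
theorem InterchangeStep.exists_sigmaM_eq {m n : ℕ} {M M' : Fin m → Fin n → ℕ}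
    (h : InterchangeStep M M') :
    ∃ (i j : Fin m) (k l : Fin n), i < j ∧ k < l ∧
      M i k = 0 ∧ M i l = 1 ∧ M j k = 1 ∧ M j l = 0 ∧
      ∀ p q, sigmaM M' p q = sigmaM M p q + if (i ≤ p ∧ p < j) ∧ (k ≤ q ∧ q < l) then 1 else 0 := by
  obtain ⟨i, j, k, l, hij, hkl, h1, h2, h3, h4, h5, h6, h7, h8, hrest⟩ := h
  refine ⟨i, j, k, l, hij, hkl, h1, h2, h3, h4, fun p q => ?_⟩
  have entry : ∀ a b, M' a b + (if a = i then if b = l then 1 else 0 else 0)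
      + (if a = j then if b = k then 1 else 0 else 0)
      = M a b + (if a = i then if b = k then 1 else 0 else 0)
      + (if a = j then if b = l then 1 else 0 else 0) := by
    intro a b
    have := hrest a b
    have := hij.ne
    have := hkl.ne
    grind
  have total := Finset.sum_congr (rfl : univ.filter (fun a : Fin m => a ≤ p) = _) fun a _ =>
    Finset.sum_congr (rfl : univ.filter (fun b : Fin n => b ≤ q) = _) fun b _ => entry a b
  have corner : ∀ (x : Fin m) (y : Fin n),
      (∑ a ∈ univ.filter (fun a : Fin m => a ≤ p), ∑ b ∈ univ.filter (fun b : Fin n => b ≤ q),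
        if a = x then if b = y then 1 else 0 else 0) = if x ≤ p ∧ y ≤ q then 1 else 0 := by
    intro x y
    rw [Finset.sum_comm]
    simp only [Finset.sum_ite_eq', Finset.mem_filter, Finset.mem_univ, true_and]
    split_ifs <;> simp_all
  simp only [Finset.sum_add_distrib, corner] at total
  change sigmaM M' p q + _ + _ = sigmaM M p q + _ + _ at total
  grind

theorem InterchangeStep.bruhatLE {m n : ℕ} {M M' : Fin m → Fin n → ℕ}
    (h : InterchangeStep M M') : bruhatLE M' M := by
  obtain ⟨i, j, k, l, -, -, -, -, -, -, hσ⟩ := h.exists_sigmaM_eq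
  intro p q
  rw [hσ]
  exact Nat.le_add_right _ _

theorem bruhatLE_of_secBLE {m n : ℕ} {M₁ M₂ : Fin m → Fin n → ℕ}
    (h : secBLE M₁ M₂) : bruhatLE M₁ M₂ := by
  induction h with
  | refl => exact fun _ _ => le_rfl
  | tail _ hstep ih => exact fun p q => (ih p q).trans (hstep.bruhatLE p q)

/-- If every interchange available in `M₂` has a point of its rectangle where `M₁` and `M₂` leave
no room in `sigmaM`, then `M₁` cannot be reached from `M₂`. -/
theorem not_secBLE_of_tight {m n : ℕ} {M₁ M₂ : Fin m → Fin n → ℕ} (hne : M₁ ≠ M₂)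
    (htight : ∀ i j k l, M₂ i k = 0 → M₂ i l = 1 → M₂ j k = 1 → M₂ j l = 0 → i < j → k < l →
      ∃ p q, ((i ≤ p ∧ p < j) ∧ (k ≤ q ∧ q < l)) ∧ sigmaM M₁ p q ≤ sigmaM M₂ p q) :
    ¬ secBLE M₁ M₂ := by
  intro h
  rcases Relation.ReflTransGen.cases_head h with heq | ⟨N, hstep, hN⟩
  · exact hne heq.symm
  · obtain ⟨i, j, k, l, hij, hkl, h1, h2, h3, h4, hσ⟩ := hstep.exists_sigmaM_eq
    obtain ⟨p, q, hpq, hle⟩ := htight i j k l h1 h2 h3 h4 hij hkl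
    have hNp := bruhatLE_of_secBLE hN p q
    rw [hσ, if_pos hpq] at hNp
    omega

/-- The Brualdi–Deaett counterexample: two matrices in `BCT((1,4,5,2,1,3),(3,1,2,5,4,1))`
comparable in the combinatorial Bruhat order but not in the secondary Bruhat order;
in particular the two combinatorial Bruhat orders differ on this set. -/
theorem bruhat_orders_differ :
    isBCT (![1,4,5,2,1,3]) (![3,1,2,5,4,1])
      (![![1,0,0,0,0,0], ![1,0,1,1,1,0], ![1,1,1,1,1,0],
         ![0,0,0,1,1,0], ![0,0,0,1,0,0], ![0,0,0,1,1,1]]) ∧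
    isBCT (![1,4,5,2,1,3]) (![3,1,2,5,4,1])
      (![![0,0,0,1,0,0], ![1,1,0,1,1,0], ![1,0,1,1,1,1],
         ![1,0,0,1,0,0], ![0,0,0,0,1,0], ![0,0,1,1,1,0]]) ∧
    bruhatLE
      (![![1,0,0,0,0,0], ![1,0,1,1,1,0], ![1,1,1,1,1,0],
         ![0,0,0,1,1,0], ![0,0,0,1,0,0], ![0,0,0,1,1,1]])
      (![![0,0,0,1,0,0], ![1,1,0,1,1,0], ![1,0,1,1,1,1],
         ![1,0,0,1,0,0], ![0,0,0,0,1,0], ![0,0,1,1,1,0]]) ∧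
    ¬ secBLE
      (![![1,0,0,0,0,0], ![1,0,1,1,1,0], ![1,1,1,1,1,0],
         ![0,0,0,1,1,0], ![0,0,0,1,0,0], ![0,0,0,1,1,1]])
      (![![0,0,0,1,0,0], ![1,1,0,1,1,0], ![1,0,1,1,1,1],
         ![1,0,0,1,0,0], ![0,0,0,0,1,0], ![0,0,1,1,1,0]]) := by
  refine ⟨⟨by decide, by decide, by decide⟩, ⟨by decide, by decide, by decide⟩,
    by unfold bruhatLE; decide +kernel, not_secBLE_of_tight (by decide) (by decide +kernel)⟩
end

section
/- Let r ∈ ℕ^m, c ∈ ℕ^n with equal coordinate sums, M = (m_{ij}) ∈ BCT(r,c), columns k < l and rows i ≤ j such that M[{i,...,j},{k,l}] is a minimal matched block whose top row is (0,1) (i.e. m_{ik}=0, m_{il}=1). Let M' be obtained from M by swapping the two columns of this block, i.e. m'_{pk} = m_{pl} and m'_{pl} = m_{pk} for all i ≤ p ≤ j, and m'_{pq} = m_{pq} for all other entries. Then M' ∈ BCT(r,c) and M' ≤_{secB} M in the combinatorial secondary Bruhat order. -/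
open Finset

/-- Sum of the entries of column `q` of `M` over the rows `p` with `a ≤ p ≤ b`. -/
def blockSum {m n : ℕ} (M : Fin m → Fin n → ℕ) (a b : ℕ) (q : Fin n) : ℕ :=
  ∑ p ∈ Finset.univ.filter (fun p : Fin m => a ≤ p.val ∧ p.val ≤ b), M p q

/-- The two-column submatrix `M[{a,...,b},{k,l}]` is a matched block: its two columns
have equal sums. -/
def MatchedBlock {m n : ℕ} (M : Fin m → Fin n → ℕ) (a b : ℕ) (k l : Fin n) : Prop :=
  blockSum M a b k = blockSum M a b l

/-- A matched block is minimal if it cannot be partitioned into two matched sub-blocks. -/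
def MinimalMatchedBlock {m n : ℕ} (M : Fin m → Fin n → ℕ) (a b : ℕ) (k l : Fin n) : Prop :=
  MatchedBlock M a b k l ∧
    ¬ ∃ t : ℕ, a ≤ t ∧ t < b ∧ MatchedBlock M a t k l ∧ MatchedBlock M (t + 1) b k l

/-- The row sums of `M` in column `l` minus column `k`, over the rows in `S` up to `t`. -/
def prefixExcess {m n : ℕ} (M : Fin m → Fin n → ℕ) (S : Finset (Fin m)) (k l : Fin n)
    (t : Fin m) : ℤ :=
  ∑ p ∈ S with p ≤ t, ((M p l : ℤ) - M p k)

/-- Exchanging the rows `(0,1)` and `(1,0)` indexed by `S` in columns `k < l` goes down in the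
secondary Bruhat order when the rows `(0,1)` dominate in every initial part of `S` and both
kinds are equally frequent in `S`. -/
theorem secBLE_of_prefixExcess_nonneg {m n : ℕ} {k l : Fin n} (hkl : k < l)
    (M' : Fin m → Fin n → ℕ) (S : Finset (Fin m)) (M : Fin m → Fin n → ℕ)
    (hS : ∀ p ∈ S, (M p k = 0 ∧ M p l = 1 ∧ M' p k = 1 ∧ M' p l = 0) ∨
      (M p k = 1 ∧ M p l = 0 ∧ M' p k = 0 ∧ M' p l = 1))
    (hrest : ∀ p q, ¬(p ∈ S ∧ (q = k ∨ q = l)) → M' p q = M p q)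
    (hpre : ∀ t, 0 ≤ prefixExcess M S k l t)
    (htot : ∑ p ∈ S, ((M p l : ℤ) - M p k) = 0) :
    secBLE M' M := by
  induction S using Finset.strongInduction generalizing M with
  | H S ih =>
  rcases S.eq_empty_or_nonempty with rfl | hne
  · have : M' = M := by
      funext p q
      exact hrest p q (by simp)
    rw [this]
    exact Relation.ReflTransGen.refl
  -- `b` is the first row `(1,0)` of `S`, and `a` a row `(0,1)` above it.
  have hneg : {p ∈ S | M p k = 1}.Nonempty := by
    by_contra hcon
    rw [Finset.not_nonempty_iff_eq_empty, Finset.filter_eq_empty_iff] at hcon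
    have : 0 < ∑ p ∈ S, ((M p l : ℤ) - M p k) := by
      refine Finset.sum_pos (fun p hp => ?_) hne
      have h1 := hcon hp
      rcases hS p hp with h | h <;> omega
    omega
  set b := {p ∈ S | M p k = 1}.min' hneg with hb
  have hbmem := Finset.min'_mem _ hneg
  rw [← hb, Finset.mem_filter] at hbmem
  obtain ⟨hbS, hbk⟩ := hbmem
  have hbmin : ∀ p ∈ S, p < b → M p k = 0 ∧ M p l = 1 := by
    intro p hp hpb
    rcases hS p hp with h | h
    · exact ⟨h.1, h.2.1⟩
    · exact absurd (Finset.min'_le _ p (Finset.mem_filter.2 ⟨hp, h.1⟩)) (not_le.2 hpb)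
  have hB : M b k = 1 ∧ M b l = 0 ∧ M' b k = 0 ∧ M' b l = 1 := by
    rcases hS b hbS with h | h
    · omega
    · exact h
  obtain ⟨a, haS, hab⟩ : ∃ a ∈ S, a < b := by
    by_contra! hcon
    have hfil : {p ∈ S | p ≤ b} = {b} := by
      ext p
      simp only [Finset.mem_filter, Finset.mem_singleton]
      constructor
      · rintro ⟨h1, h2⟩
        exact le_antisymm h2 (hcon p h1)
      · rintro rfl
        exact ⟨hbS, le_rfl⟩
    have := hpre b
    rw [prefixExcess, hfil, Finset.sum_singleton] at this
    omega
  have hA : M a k = 0 ∧ M a l = 1 ∧ M' a k = 1 ∧ M' a l = 0 := by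
    have := hbmin a haS hab
    rcases hS a haS with h | h
    · exact h
    · omega
  let N : Fin m → Fin n → ℕ := fun p q =>
    if (p = a ∨ p = b) ∧ (q = k ∨ q = l) then M' p q else M p q
  have hstep : InterchangeStep M N := by
    refine ⟨a, b, k, l, hab, hkl, hA.1, hA.2.1, hB.1, hB.2.1, ?_, ?_, ?_, ?_, ?_⟩
    · simpa [N] using hA.2.2.1
    · simpa [N] using hA.2.2.2
    · simpa [N] using hB.2.2.1
    · simpa [N] using hB.2.2.2
    · intro p q h
      exact if_neg h
  let T := (S.erase b).erase a
  have hTmem : ∀ p, p ∈ T ↔ p ≠ a ∧ p ≠ b ∧ p ∈ S := by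
    intro p
    simp [T]
  have hNM : ∀ p ∈ T, ∀ q, N p q = M p q := by
    intro p hp q
    have := (hTmem p).1 hp
    exact if_neg (by tauto)
  have hsplit : ∀ f : Fin m → ℤ, ∑ p ∈ S, f p = f a + f b + ∑ p ∈ T, f p := by
    intro f
    rw [← Finset.add_sum_erase S f hbS,
      ← Finset.add_sum_erase (S.erase b) f (Finset.mem_erase.2 ⟨hab.ne, haS⟩)]
    ring
  have hTS : T ⊂ S := by
    refine Finset.ssubset_iff_of_subset (fun p hp => ((hTmem p).1 hp).2.2) |>.2 ⟨a, haS, ?_⟩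
    simp [T]
  refine Relation.ReflTransGen.head hstep (ih T hTS N ?_ ?_ ?_ ?_)
  · intro p hp
    rw [hNM p hp, hNM p hp]
    exact hS p ((hTmem p).1 hp).2.2
  · intro p q h
    by_cases hpq : (p = a ∨ p = b) ∧ (q = k ∨ q = l)
    · exact (if_pos hpq).symm
    · refine (hrest p q ?_).trans (if_neg hpq).symm
      rw [hTmem] at h
      tauto
  · intro t
    have hN : prefixExcess N T k l t = ∑ p ∈ T with p ≤ t, ((M p l : ℤ) - M p k) := by
      refine Finset.sum_congr rfl fun p hp => ?_
      rw [hNM p (Finset.mem_filter.1 hp).1, hNM p (Finset.mem_filter.1 hp).1]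
    rw [hN]
    by_cases htb : t < b
    · refine Finset.sum_nonneg fun p hp => ?_
      rw [Finset.mem_filter] at hp
      have := hbmin p ((hTmem p).1 hp.1).2.2 (hp.2.trans_lt htb)
      omega
    · have h := hpre t
      rw [not_lt] at htb
      rw [prefixExcess, Finset.sum_filter, hsplit, if_pos (hab.le.trans htb), if_pos htb,
        ← Finset.sum_filter] at h
      omega
  · have h := hsplit fun p => (M p l : ℤ) - M p k
    rw [htot] at h
    rw [Finset.sum_congr rfl fun p hp => by rw [hNM p hp, hNM p hp]]
    omega

theorem blockSum_add_blockSum {m n : ℕ} (M : Fin m → Fin n → ℕ) {a t b : ℕ} (hat : a ≤ t)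
    (htb : t < b) (q : Fin n) :
    blockSum M a b q = blockSum M a t q + blockSum M (t + 1) b q := by
  simp only [blockSum, Finset.sum_filter]
  rw [← Finset.sum_add_distrib]
  refine Finset.sum_congr rfl fun p _ => ?_
  split_ifs <;> omega

theorem blockSum_self {m n : ℕ} (M : Fin m → Fin n → ℕ) (p : Fin m) (q : Fin n) :
    blockSum M p p q = M p q := by
  have : (univ.filter fun x : Fin m => p.val ≤ x.val ∧ x.val ≤ p.val) = {p} := by
    ext x
    simp [le_antisymm_iff, and_comm]
  rw [blockSum, this, Finset.sum_singleton]

/-- In a minimal matched block of a 0-1 matrix with top row `(0,1)`, the right column sum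
exceeds the left one on every proper initial part. -/
theorem MinimalMatchedBlock.blockSum_lt {m n : ℕ} {M : Fin m → Fin n → ℕ} {i j : Fin m}
    {k l : Fin n} (h01 : ∀ p q, M p q = 0 ∨ M p q = 1)
    (hmin : MinimalMatchedBlock M i.val j.val k l) (hik : M i k = 0) (hil : M i l = 1)
    (t : ℕ) (hit : i.val ≤ t) (htj : t < j.val) :
    blockSum M i t k < blockSum M i t l := by
  induction t, hit using Nat.le_induction with
  | base => rw [blockSum_self, blockSum_self]; omega
  | succ t hit ih =>
    have ih := ih (by omega)
    have hne : blockSum M i (t + 1) k ≠ blockSum M i (t + 1) l := by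
      intro h
      refine hmin.2 ⟨t + 1, by omega, htj, h, ?_⟩
      have h1 : blockSum M i j k = blockSum M i j l := hmin.1
      have hik' : i.val ≤ t + 1 := by omega
      rw [blockSum_add_blockSum M hik' htj, blockSum_add_blockSum M hik' htj] at h1
      unfold MatchedBlock
      omega
    have hs : ∀ q, blockSum M i (t + 1) q
        = blockSum M i t q + M ⟨t + 1, htj.trans j.isLt⟩ q := fun q => by
      rw [blockSum_add_blockSum M hit (Nat.lt_succ_self t)]
      exact congrArg _ (blockSum_self M ⟨t + 1, htj.trans j.isLt⟩ q)
    rw [hs, hs] at hne ⊢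
    have hk := h01 ⟨t + 1, htj.trans j.isLt⟩ k
    have hl := h01 ⟨t + 1, htj.trans j.isLt⟩ l
    omega

/-- Swapping the columns of a matched block preserves row and column sums. -/
theorem isBCT_of_swap_matchedBlock {m n : ℕ} {r : Fin m → ℕ} {c : Fin n → ℕ}
    {M M' : Fin m → Fin n → ℕ} (hM : isBCT r c M) {i j : Fin m} {k l : Fin n}
    (hmat : MatchedBlock M i.val j.val k l)
    (hswap : ∀ p : Fin m, i ≤ p → p ≤ j → M' p k = M p l ∧ M' p l = M p k)
    (hrest : ∀ (p : Fin m) (q : Fin n),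
      ¬(i ≤ p ∧ p ≤ j ∧ (q = k ∨ q = l)) → M' p q = M p q) :
    isBCT r c M' := by
  obtain ⟨h01, hr, hc⟩ := hM
  have hrow : ∀ p, i ≤ p → p ≤ j → ∀ q, M' p q = M p (Equiv.swap k l q) := by
    intro p h1 h2 q
    by_cases hk : q = k
    · subst hk
      simpa using (hswap p h1 h2).1
    by_cases hl : q = l
    · subst hl
      simpa using (hswap p h1 h2).2
    rw [Equiv.swap_apply_of_ne_of_ne hk hl]
    exact hrest p q (by tauto)
  have hcol : ∀ q q', (∀ p, i ≤ p → p ≤ j → M' p q = M p q') →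
      blockSum M i j q = blockSum M i j q' → ∑ p, M' p q = ∑ p, M p q := by
    intro q q' h hb
    rw [← Finset.sum_filter_add_sum_filter_not univ
        (fun p : Fin m => i.val ≤ p.val ∧ p.val ≤ j.val),
      ← Finset.sum_filter_add_sum_filter_not univ
        (fun p : Fin m => i.val ≤ p.val ∧ p.val ≤ j.val) (fun p => M p q)]
    congr 1
    · refine Eq.trans (Finset.sum_congr rfl fun p hp => ?_) hb.symm
      rw [Finset.mem_filter] at hp
      exact h p hp.2.1 hp.2.2
    · refine Finset.sum_congr rfl fun p hp => hrest p q ?_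
      rw [Finset.mem_filter] at hp
      exact fun h => hp.2 ⟨h.1, h.2.1⟩
  refine ⟨fun p q => ?_, fun p => ?_, fun q => ?_⟩
  · by_cases h : i ≤ p ∧ p ≤ j
    · rw [hrow p h.1 h.2]
      exact h01 _ _
    · rw [hrest p q (by tauto)]
      exact h01 _ _
  · rw [← hr p]
    by_cases h : i ≤ p ∧ p ≤ j
    · rw [← Equiv.sum_comp (Equiv.swap k l) (M p)]
      exact Finset.sum_congr rfl fun q _ => hrow p h.1 h.2 q
    · exact Finset.sum_congr rfl fun q _ => hrest p q (by tauto)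
  · rw [← hc q]
    by_cases hk : q = k
    · subst hk
      exact hcol q l (fun p h1 h2 => (hswap p h1 h2).1) hmat
    by_cases hl : q = l
    · subst hl
      exact hcol q k (fun p h1 h2 => (hswap p h1 h2).2) hmat.symm
    exact Finset.sum_congr rfl fun p _ => hrest p q (by tauto)

/-- Swapping the two columns of a minimal matched block whose top row is `(0,1)` produces
a matrix in `BCT(r,c)` which is below the original in the secondary Bruhat order. -/
theorem block_swap_le_secB {m n : ℕ} (r : Fin m → ℕ) (c : Fin n → ℕ)
    (hsum : ∑ i, r i = ∑ j, c j)
    (M M' : Fin m → Fin n → ℕ) (hM : isBCT r c M)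
    (i j : Fin m) (k l : Fin n) (hij : i ≤ j) (hkl : k < l)
    (hmin : MinimalMatchedBlock M i.val j.val k l)
    (hik : M i k = 0) (hil : M i l = 1)
    (hswap : ∀ p : Fin m, i ≤ p → p ≤ j → M' p k = M p l ∧ M' p l = M p k)
    (hrest : ∀ (p : Fin m) (q : Fin n),
      ¬(i ≤ p ∧ p ≤ j ∧ (q = k ∨ q = l)) → M' p q = M p q) :
    isBCT r c M' ∧ secBLE M' M := by
  obtain ⟨h01, -, -⟩ := id hM
  refine ⟨isBCT_of_swap_matchedBlock hM hmin.1 hswap hrest, ?_⟩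
  let S : Finset (Fin m) := {p | (i ≤ p ∧ p ≤ j) ∧ M p k ≠ M p l}
  have hS : ∀ p, p ∈ S ↔ (i ≤ p ∧ p ≤ j) ∧ M p k ≠ M p l := by simp [S]
  have hblock : ∀ t : Fin m, t ≤ j →
      prefixExcess M S k l t = (blockSum M i t l : ℤ) - blockSum M i t k := by
    intro t ht
    simp only [prefixExcess, S, blockSum, Finset.filter_filter, Finset.sum_filter]
    push_cast
    rw [← Finset.sum_sub_distrib]
    refine Finset.sum_congr rfl fun p _ => ?_
    simp only [Fin.le_def] at ht ⊢
    split_ifs <;> omega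
  have hend : prefixExcess M S k l j = 0 := by
    have h1 : blockSum M i j k = blockSum M i j l := hmin.1
    rw [hblock j le_rfl]
    omega
  have hlate : ∀ t, j ≤ t →
      prefixExcess M S k l t = ∑ p ∈ S, ((M p l : ℤ) - M p k) := by
    intro t ht
    rw [prefixExcess, Finset.filter_true_of_mem fun p hp => ((hS p).1 hp).1.2.trans ht]
  have htot : ∑ p ∈ S, ((M p l : ℤ) - M p k) = 0 := (hlate j le_rfl).symm.trans hend
  refine secBLE_of_prefixExcess_nonneg hkl M' S M ?_ ?_ ?_ htot
  · intro p hp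
    obtain ⟨⟨h1, h2⟩, h3⟩ := (hS p).1 hp
    have h4 := hswap p h1 h2
    have h5 := h01 p k
    have h6 := h01 p l
    omega
  · intro p q h
    by_cases hpq : i ≤ p ∧ p ≤ j ∧ (q = k ∨ q = l)
    · obtain ⟨h1, h2, h3⟩ := hpq
      have h4 : M p k = M p l := by
        by_contra h4
        exact h ⟨(hS p).2 ⟨⟨h1, h2⟩, h4⟩, h3⟩
      rcases h3 with rfl | rfl
      · rw [(hswap p h1 h2).1, h4]
      · rw [(hswap p h1 h2).2, h4]
    · exact hrest p q hpq
  · intro t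
    rcases le_or_gt j t with hjt | htj
    · rw [hlate t hjt, htot]
    rcases lt_or_ge t i with hti | hit
    · refine Finset.sum_nonneg fun p hp => ?_
      rw [Finset.mem_filter, hS] at hp
      exact absurd (hp.1.1.1.trans hp.2) (not_le.2 hti)
    · rw [hblock t htj.le]
      have := hmin.blockSum_lt h01 hik hil t hit htj
      omega
end
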